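/- (HW-reduced state reconstruction.) Assume gcd(N, M) = 1 and let ρ : Matrix S S ℂ. Then the HW-reduced density matrix satisfies ρ_HW = (1/M) · Σ_{k,l ∈ ZMod M} (trace(ρ * Λ_{k,l})) • (L_{k, N·l})ᴴ. -/

import Mathlib

open Matrix Complex BigOperators Finset

noncomputable section

set_option linter.unusedVariables false

/-- `ω = exp(2πi/M)`. -/
def hwOmega (M : ℕ) : ℂ := Complex.exp (2 * Real.pi * Complex.I / M)

/-- Single-photon Heisenberg–Weyl matrix `L_{k,l} = X^k Z^l`,
with entries `L_{k,l}[m,m'] = ω^{l·m'}` if `m = m' + k` and `0` otherwise. -/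
def HW (M : ℕ) [NeZero M] (k l : ZMod M) : Matrix (ZMod M) (ZMod M) ℂ :=
  Matrix.of fun m m' => if m = m' + k then hwOmega M ^ (l * m').val else 0

/-- Fock vectors: mode-occupation functions `ZMod M → ℕ` with total photon number `N`. -/
abbrev Fock (M N : ℕ) [NeZero M] := {n : ZMod M → ℕ // ∑ m, n m = N}

instance (M N : ℕ) [NeZero M] : Fintype (Fock M N) :=
  Fintype.ofInjective
    (fun n (m : ZMod M) => (⟨n.1 m, Nat.lt_succ_of_le (le_of_le_of_eq
      (Finset.single_le_sum (fun i _ => Nat.zero_le _) (Finset.mem_univ m)) n.2)⟩ : Fin (N+1)))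
    (fun a b h => Subtype.ext (funext fun m => congrArg Fin.val (congrFun h m)))

/-- The mode shift `σ`, `(σ n)(m) = n(m - 1)`. -/
def modeShift (M N : ℕ) [NeZero M] (n : Fock M N) : Fock M N :=
  ⟨fun m => n.1 (m - 1), by
    exact (Fintype.sum_equiv (Equiv.subRight (1 : ZMod M)) _ _ (fun m => rfl)).trans n.2⟩

/-- The total mode index `μ(n) = ∑ m, m·n(m) ∈ ZMod M`. -/
def tmi (M N : ℕ) [NeZero M] (n : Fock M N) : ZMod M := ∑ m : ZMod M, m * (n.1 m : ZMod M)

/-- Multiphoton Heisenberg–Weyl matrix `Λ_{k,l}`, with entries `ω^{l·μ(n)}` at `(σ^k n, n)`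
and `0` elsewhere. -/
def HWm (M N : ℕ) [NeZero M] (k l : ZMod M) : Matrix (Fock M N) (Fock M N) ℂ :=
  Matrix.of fun v n =>
    if v = (modeShift M N)^[k.val] n then hwOmega M ^ (l * tmi M N n).val else 0

/-- The HW-reduced density matrix,
`ρ_HW[m,m'] = ∑_{ñ ∈ S, μ(ñ) = 0} ρ[σ^m ñ, σ^{m'} ñ]`. -/
def rhoHW (M N : ℕ) [NeZero M] (ρ : Matrix (Fock M N) (Fock M N) ℂ) :
    Matrix (ZMod M) (ZMod M) ℂ :=
  Matrix.of fun m m' => ∑ t : Fock M N,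
    if tmi M N t = 0 then ρ ((modeShift M N)^[m.val] t) ((modeShift M N)^[m'.val] t) else 0

open ZMod in
lemma hwOmega_pow_val (M : ℕ) [NeZero M] (a : ZMod M) :
    hwOmega M ^ a.val = stdAddChar a := by
  rw [stdAddChar_apply, toCircle_apply, hwOmega, ← Complex.exp_nat_mul]
  congr 1
  ring

lemma modeShift_iterate_apply (M N : ℕ) [NeZero M] (j : ℕ) (n : Fock M N) (m : ZMod M) :
    ((modeShift M N)^[j] n).1 m = n.1 (m - j) := by
  induction j generalizing m with
  | zero => simp
  | succ j ih =>
    rw [Function.iterate_succ_apply']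
    change ((modeShift M N)^[j] n).1 (m - 1) = _
    rw [ih]
    exact congrArg n.1 (by push_cast; ring)

lemma modeShift_iterate_val_add (M N : ℕ) [NeZero M] (a b : ZMod M) (n : Fock M N) :
    (modeShift M N)^[a.val] ((modeShift M N)^[b.val] n) = (modeShift M N)^[(a + b).val] n := by
  ext m
  simp only [modeShift_iterate_apply, ZMod.natCast_zmod_val]
  exact congrArg n.1 (by ring)

/-- The shift by `k ∈ ZMod M` modes as a permutation of the Fock vectors. -/
def modeShiftEquiv (M N : ℕ) [NeZero M] (k : ZMod M) : Fock M N ≃ Fock M N where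
  toFun := (modeShift M N)^[k.val]
  invFun := (modeShift M N)^[(-k).val]
  left_inv n := by simp [modeShift_iterate_val_add]
  right_inv n := by simp [modeShift_iterate_val_add]

lemma tmi_modeShift_iterate (M N : ℕ) [NeZero M] (k : ZMod M) (n : Fock M N) :
    tmi M N ((modeShift M N)^[k.val] n) = tmi M N n + N * k := by
  have hsum : ∑ m, (n.1 m : ZMod M) = N := by exact_mod_cast congrArg (Nat.cast (R := ZMod M)) n.2
  simp only [tmi, modeShift_iterate_apply, ZMod.natCast_zmod_val]
  rw [← hsum, Finset.sum_mul, ← Finset.sum_add_distrib]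
  refine Fintype.sum_equiv (Equiv.subRight k) _ _ fun m => ?_
  simp only [Equiv.subRight_apply]
  ring

lemma trace_mul_HWm (M N : ℕ) [NeZero M] (ρ : Matrix (Fock M N) (Fock M N) ℂ) (k l : ZMod M) :
    Matrix.trace (ρ * HWm M N k l) =
      ∑ n, ρ n ((modeShift M N)^[k.val] n) * ZMod.stdAddChar (l * tmi M N n) := by
  simp [Matrix.trace, Matrix.mul_apply, HWm, hwOmega_pow_val]

lemma HW_conjTranspose_apply (M : ℕ) [NeZero M] (k l m m' : ZMod M) :
    (HW M k l)ᴴ m m' = if m' = m + k then ZMod.stdAddChar (-(l * m)) else 0 := by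
  simp only [conjTranspose_apply, HW, of_apply, hwOmega_pow_val, AddChar.map_neg_eq_conj]
  split_ifs <;> simp

lemma rhoHW_apply (M N : ℕ) [NeZero M] (ρ : Matrix (Fock M N) (Fock M N) ℂ) (m m' : ZMod M) :
    rhoHW M N ρ m m' =
      ∑ n, if tmi M N n = N * m then ρ n ((modeShift M N)^[(m' - m).val] n) else 0 := by
  simp only [rhoHW, of_apply]
  refine Fintype.sum_equiv (modeShiftEquiv M N m) _ _ fun t => ?_
  simp [modeShiftEquiv, tmi_modeShift_iterate, modeShift_iterate_val_add]

lemma sum_stdAddChar_mul_sub (M : ℕ) [NeZero M] (a b : ZMod M) :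
    ∑ l : ZMod M, ZMod.stdAddChar (l * (a - b)) = if a = b then (M : ℂ) else 0 := by
  simp [AddChar.sum_mulShift _ (ZMod.isPrimitive_stdAddChar M), sub_eq_zero, ZMod.card]

/-- HW-reduced state reconstruction:
`ρ_HW = (1/M) Σ_{k,l} tr(ρ Λ_{k,l}) • (L_{k,N·l})ᴴ`. -/
theorem rhoHW_reconstruction (M N : ℕ) [NeZero M] (hN : 1 ≤ N)
    (hgcd : Nat.gcd N M = 1) (ρ : Matrix (Fock M N) (Fock M N) ℂ) :
    rhoHW M N ρ = (1 / (M : ℂ)) • ∑ k : ZMod M, ∑ l : ZMod M,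
      (Matrix.trace (ρ * HWm M N k l)) • (HW M k ((N : ZMod M) * l))ᴴ := by
  have hM : (M : ℂ) ≠ 0 := NeZero.ne _
  ext m m'
  have hk (k : ZMod M) : m' = m + k ↔ k = m' - m := by
    rw [eq_sub_iff_add_eq', eq_comm]
  simp only [Matrix.smul_apply, Matrix.sum_apply, smul_eq_mul, HW_conjTranspose_apply, trace_mul_HWm,
    rhoHW_apply, hk, mul_ite, mul_zero]
  rw [Finset.sum_comm]
  simp only [Finset.sum_ite_eq', Finset.mem_univ, if_true, Finset.sum_mul]
  rw [Finset.sum_comm, Finset.mul_sum]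
  refine Finset.sum_congr rfl fun n _ => ?_
  have hphase (l : ZMod M) : (ZMod.stdAddChar (l * tmi M N n) : ℂ) *
      ZMod.stdAddChar (-((N : ZMod M) * l * m)) = ZMod.stdAddChar (l * (tmi M N n - (N : ZMod M) * m)) := by
    rw [← AddChar.map_add_eq_mul]
    congr 1
    ring
  simp only [mul_assoc (ρ _ _), hphase, ← Finset.mul_sum, sum_stdAddChar_mul_sub]
  split_ifs
  · field_simp
  · simp

end
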